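/- arXiv:1610.04010 — 5 statements merged into one kernel-verified Lean document; each statement's English description precedes it below -/
import Mathlib

section
/- Let G be a directed graph on a finite vertex set V, let s ∈ V, let k ≥ 1, and let H be a k-FTRS of G with respect to s. Let A ⊆ V be a set containing s such that every directed path in G from s to a vertex of A has all of its vertices in A. Then the induced subgraph H(A) is a k-FTRS of the induced subgraph G(A) with respect to s; that is, for every set F of at most k edges of G(A) and every vertex v ∈ A, v is reachable from s in G(A)∖F if and only if v is reachable from s in H(A)∖F. -/
/-- `v` is reachable from `u` in the directed graph with edge set `E`
(via a directed path, possibly of length 0). -/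
def DReach {V : Type*} (E : Set (V × V)) (u v : V) : Prop :=
  Relation.ReflTransGen (fun a b => (a, b) ∈ E) u v

/-- `H` is a `k`-fault-tolerant reachability subgraph (`k`-FTRS) of the graph
with edge set `E` with respect to the source `s` : `H` is a subgraph of `E`, and
for every set `F` of at most `k` edges of `E` and every vertex `v`, `v` is
reachable from `s` in `E ∖ F` iff `v` is reachable from `s` in `H ∖ F`. -/
def IsKFTRS {V : Type*} (k : ℕ) (E H : Set (V × V)) (s : V) : Prop :=
  H ⊆ E ∧ ∀ F : Finset (V × V), ↑F ⊆ E → F.card ≤ k →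
    ∀ v : V, DReach (E \ ↑F) s v ↔ DReach (H \ ↑F) s v

theorem DReach.mono {V : Type*} {E E' : Set (V × V)} (h : E ⊆ E') {u v : V}
    (huv : DReach E u v) : DReach E' u v :=
  Relation.ReflTransGen.mono (fun _ _ hab => h hab) _ _ huv

/-- If every vertex reachable from `s` with an edge into `A` lies in `A`, then a vertex of `A`
reachable from `s` is reachable inside the induced subgraph on `A`. -/
theorem DReach.induce {V : Type*} {E : Set (V × V)} {s v : V} {A : Set V}
    (hA : ∀ a b, DReach E s a → (a, b) ∈ E → b ∈ A → a ∈ A)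
    (h : DReach E s v) (hv : v ∈ A) : DReach (E ∩ A ×ˢ A) s v := by
  induction h with
  | refl => exact .refl
  | tail hab hbc ih =>
    have hb := hA _ _ hab hbc hv
    exact (ih hb).tail ⟨hbc, hb, hv⟩

/-- Lemma 2 of the paper. If `H` is a `k`-FTRS of `G` w.r.t. `s`,
`A` is a set of vertices containing `s` such that every directed path in `G` from
`s` to a vertex of `A` has all of its vertices in `A`, then the induced subgraph
`H(A)` is a `k`-FTRS of the induced subgraph `G(A)` w.r.t. `s`: for every set `F`
of at most `k` edges of `G(A)` and every `v ∈ A`, `v` is reachable from `s` in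
`G(A) ∖ F` iff `v` is reachable from `s` in `H(A) ∖ F`. -/
theorem kftrs_induced_subgraph {V : Type*} [Fintype V]
    (E H : Set (V × V)) (s : V) (k : ℕ) (hk : 1 ≤ k)
    (hFTRS : IsKFTRS k E H s)
    (A : Set V) (hsA : s ∈ A)
    (hclosed : ∀ p : List V, p.Chain' (fun a b => (a, b) ∈ E) →
      p.head? = some s → (∃ v ∈ A, p.getLast? = some v) → ∀ x ∈ p, x ∈ A) :
    ∀ F : Finset (V × V), ↑F ⊆ E ∩ A ×ˢ A → F.card ≤ k →
      ∀ v ∈ A, DReach ((E ∩ A ×ˢ A) \ ↑F) s v ↔ DReach ((H ∩ A ×ˢ A) \ ↑F) s v := by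
  have hpred : ∀ a b, DReach E s a → (a, b) ∈ E → b ∈ A → a ∈ A := by
    intro a b ha hab hb
    obtain ⟨l, hl, hlast⟩ := List.exists_isChain_cons_of_relationReflTransGen ha
    refine hclosed (s :: l ++ [b]) ?_ rfl ⟨b, hb, List.getLast?_concat⟩ a ?_
    · refine List.isChain_append.2 ⟨hl, List.isChain_singleton b, ?_⟩
      intro x hx y hy
      rw [List.getLast?_eq_some_getLast (List.cons_ne_nil s l), hlast] at hx
      simp only [Option.mem_def, Option.some.injEq, List.head?_cons] at hx hy
      exact hx ▸ hy ▸ hab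
    · exact List.mem_append_left _ (hlast ▸ List.getLast_mem _)
  have hind : ∀ E' ⊆ E, ∀ F : Set (V × V), ∀ v ∈ A,
      DReach ((E' ∩ A ×ˢ A) \ F) s v ↔ DReach (E' \ F) s v := by
    intro E' hE' F v hv
    have hsub : E' \ F ⊆ E := Set.sdiff_subset.trans hE'
    refine ⟨DReach.mono (Set.sdiff_subset_sdiff_left Set.inter_subset_left), fun h => ?_⟩
    refine DReach.mono ?_ (h.induce (fun a b ha hab => hpred a b (ha.mono hsub) (hsub hab)) hv)
    exact fun e he => ⟨⟨he.1.1, he.2⟩, he.1.2⟩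
  intro F hF hcard v hv
  rw [hind E subset_rfl F v hv, hind H hFTRS.1 F v hv]
  exact hFTRS.2 F (hF.trans Set.inter_subset_left) hcard v
end

section
/- Let G be a finite directed graph with a rooted spanning tree T and an injective visit numbering ν satisfying the interval property and the cross-edge property. Let a, b ∈ V be two vertices such that neither of a, b is an ancestor of the other in T, and ν(a) < ν(b). Then every directed path from a to b in G contains a vertex z that is a common ancestor of a and b in T. -/
/-- In a rooted tree given by a `parent` function, `a` is an ancestor of `b`
(reflexively: every vertex is its own ancestor) if following the parent
pointers from `b` eventually reaches `a`. -/
def IsTAncestor {V : Type*} (parent : V → V) (a b : V) : Prop :=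
  Relation.ReflTransGen (fun x y => y = parent x) b a

theorem IsTAncestor.trans {V : Type*} {parent : V → V} {a b c : V}
    (hab : IsTAncestor parent a b) (hbc : IsTAncestor parent b c) : IsTAncestor parent a c :=
  Relation.ReflTransGen.trans hbc hab

/-- A path starting at `a` that reaches a vertex numbered at least `ν b`, where `b` is a
non-descendant of `a` with `ν a < ν b`, meets a common ancestor of `a` and `b`. -/
theorem exists_common_ancestor_of_chain {V : Type*} {E : Set (V × V)} {parent : V → V}
    {ν : V → ℕ}
    (hinterval : ∀ v u : V, IsTAncestor parent v u ↔
      (ν v ≤ ν u ∧ ν u < ν v + Set.ncard {w | IsTAncestor parent v w}))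
    (hcross : ∀ x y : V, (x, y) ∈ E →
      ¬ IsTAncestor parent x y → ¬ IsTAncestor parent y x → ν y < ν x)
    {a : V} (p : List V) (hchain : p.IsChain (fun u v => (u, v) ∈ E))
    (hhead : p.head? = some a) {c : V} (hlast : p.getLast? = some c)
    {b : V} (hab : ¬ IsTAncestor parent a b) (hν_ab : ν a < ν b) (hbc : ν b ≤ ν c) :
    ∃ z ∈ p, IsTAncestor parent z a ∧ IsTAncestor parent z b := by
  have between {u v w : V} (huw : IsTAncestor parent u w) (huv : ν u ≤ ν v)
      (hvw : ν v ≤ ν w) : IsTAncestor parent u v :=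
    (hinterval u v).2 ⟨huv, hvw.trans_lt ((hinterval u w).1 huw).2⟩
  induction p using List.reverseRecOn generalizing b c with
  | nil => simp at hhead
  | append_singleton q y ih =>
    obtain rfl : y = c := by simpa using hlast
    rcases List.eq_nil_or_concat' q with rfl | ⟨r, x, rfl⟩
    · obtain rfl : y = a := by simpa using hhead
      omega
    obtain ⟨hchain', -, hstep⟩ := List.isChain_append.1 hchain
    have hxy : (x, y) ∈ E := hstep x (by simp) y (by simp)
    have hhead' : (r ++ [x]).head? = some a := by
      cases r <;> simpa using hhead
    have ih' {d : V} (had : ¬ IsTAncestor parent a d) (hν : ν a < ν d) (hdx : ν d ≤ ν x) :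
        ∃ z ∈ r ++ [x] ++ [y], IsTAncestor parent z a ∧ IsTAncestor parent z d :=
      (ih hchain' hhead' (by simp) had hν hdx).imp
        fun _ h => ⟨List.mem_append_left _ h.1, h.2⟩
    rcases le_or_gt (ν b) (ν x) with hbx | hxb
    · exact ih' hab hν_ab hbx
    have hx_anc_y : IsTAncestor parent x y := by
      by_contra hnot
      have := hcross x y hxy hnot fun h => by
        have := ((hinterval y x).1 h).1
        omega
      omega
    have hx_anc_b : IsTAncestor parent x b := between hx_anc_y hxb.le hbc
    rcases le_or_gt (ν x) (ν a) with hxa | hax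
    · exact ⟨x, by simp, between hx_anc_b hxa hν_ab.le, hx_anc_b⟩
    obtain ⟨z, hz, hza, hzx⟩ := ih' (fun h => hab (h.trans hx_anc_b)) hax le_rfl
    exact ⟨z, hz, hza, hzx.trans hx_anc_b⟩

/-- Lemma 3 of the paper, adapted from Tarjan. Let `G` be a
finite directed graph with a rooted spanning tree `T` (given by `parent`/`root`)
and an injective visit numbering `ν` satisfying the interval property and the
cross-edge property. If `a, b` are two vertices with no ancestor-descendant
relationship in `T` and `ν a < ν b`, then every directed path from `a` to `b`
in `G` contains a vertex `z` that is a common ancestor of `a` and `b` in `T`. -/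
theorem path_through_common_ancestor {V : Type*} [Fintype V]
    (E : Set (V × V)) (parent : V → V) (root : V)
    (hroot : parent root = root)
    (hspan : ∀ v : V, IsTAncestor parent root v)
    (htreeEdge : ∀ v : V, v ≠ root → (parent v, v) ∈ E)
    (ν : V → ℕ) (hν : Function.Injective ν)
    (hinterval : ∀ v u : V, IsTAncestor parent v u ↔
      (ν v ≤ ν u ∧ ν u < ν v + Set.ncard {w | IsTAncestor parent v w}))
    (hcross : ∀ x y : V, (x, y) ∈ E →
      ¬ IsTAncestor parent x y → ¬ IsTAncestor parent y x → ν y < ν x)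
    (a b : V)
    (hab : ¬ IsTAncestor parent a b) (hba : ¬ IsTAncestor parent b a)
    (hν_ab : ν a < ν b)
    (p : List V) (hchain : p.Chain' (fun u v => (u, v) ∈ E))
    (hhead : p.head? = some a) (hlast : p.getLast? = some b) :
    ∃ z ∈ p, IsTAncestor parent z a ∧ IsTAncestor parent z b :=
  exists_common_ancestor_of_chain hinterval hcross p hchain hhead hlast hab hν_ab le_rfl
end

section
/- Let H be a directed graph on a finite vertex set V and let X = (x_1, …, x_t) be a directed path in H. For any vertex w ∈ V, the strongly connected component of w in H contains a vertex of X if and only if the following two conditions hold: (i) both X^in(w) and X^out(w) exist, and (ii) X^in(w) ≤ X^out(w). -/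
/-- `u` and `v` are strongly connected in the directed graph with edge set `E`. -/
def DSConn {V : Type*} (E : Set (V × V)) (u v : V) : Prop :=
  DReach E u v ∧ DReach E v u

/-- Along a directed path, later vertices are reachable from earlier ones. -/
theorem DReach.of_path {V : Type*} {E : Set (V × V)} {t : ℕ} {x : ℕ → V}
    (hpath : ∀ i, 1 ≤ i → i < t → (x i, x (i + 1)) ∈ E) {p q : ℕ}
    (hp : 1 ≤ p) (hpq : p ≤ q) (hq : q ≤ t) : DReach E (x p) (x q) := by
  induction q, hpq using Nat.le_induction with
  | base => exact Relation.ReflTransGen.refl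
  | succ n hn ih =>
    exact Relation.ReflTransGen.tail (ih (by omega)) (hpath n (by omega) (by omega))

/-- Lemma 5 of the paper. Let `H` be a directed graph and
`X = (x 1, …, x t)` a directed path in `H`.  For a vertex `w`, the SCC of `w`
in `H` contains a vertex of `X` iff (i) both `X^in(w)` (the least index `i` with
`x i` reachable from `w`) and `X^out(w)` (the greatest index `i` with `w`
reachable from `x i`) exist, and (ii) `X^in(w) ≤ X^out(w)`. -/
theorem scc_intersects_path_iff {V : Type*} [Fintype V]
    (E : Set (V × V)) (t : ℕ) (x : ℕ → V)
    (hinj : ∀ i j, 1 ≤ i → i ≤ t → 1 ≤ j → j ≤ t → x i = x j → i = j)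
    (hpath : ∀ i, 1 ≤ i → i < t → (x i, x (i + 1)) ∈ E)
    (w : V) :
    (∃ i, 1 ≤ i ∧ i ≤ t ∧ DSConn E w (x i)) ↔
      ∃ p q, IsLeast {i | 1 ≤ i ∧ i ≤ t ∧ DReach E w (x i)} p ∧
        IsGreatest {i | 1 ≤ i ∧ i ≤ t ∧ DReach E (x i) w} q ∧ p ≤ q := by
  constructor
  · rintro ⟨i, h1, ht, hwi, hiw⟩
    have hin : i ∈ {i | 1 ≤ i ∧ i ≤ t ∧ DReach E w (x i)} := ⟨h1, ht, hwi⟩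
    have hout : i ∈ {i | 1 ≤ i ∧ i ≤ t ∧ DReach E (x i) w} := ⟨h1, ht, hiw⟩
    have hbdd : BddAbove {i | 1 ≤ i ∧ i ≤ t ∧ DReach E (x i) w} := ⟨t, fun _ hj => hj.2.1⟩
    exact ⟨_, _, ⟨Nat.sInf_mem ⟨i, hin⟩, fun _ hj => Nat.sInf_le hj⟩,
      ⟨Nat.sSup_mem ⟨i, hout⟩ hbdd, fun _ hj => le_csSup hbdd hj⟩,
      (Nat.sInf_le hin).trans (le_csSup hbdd hout)⟩
  · rintro ⟨p, q, ⟨⟨hp1, hpt, hwp⟩, -⟩, ⟨⟨-, hqt, hqw⟩, -⟩, hpq⟩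
    exact ⟨p, hp1, hpt, hwp, Relation.ReflTransGen.trans (DReach.of_path hpath hp1 hpq hqt) hqw⟩
end

section
/- Let H be a directed graph on a finite vertex set V, let X = (x_1, …, x_t) be a directed path in H, and let a, b ∈ V be two vertices whose strongly connected components in H each contain a vertex of X. Then a and b are strongly connected in H if and only if X^in(a) = X^in(b) and X^out(a) = X^out(b). -/
theorem dReach_of_le {V : Type*} {E : Set (V × V)} {t : ℕ} {x : ℕ → V}
    (hpath : ∀ i, 1 ≤ i → i < t → (x i, x (i + 1)) ∈ E) {i j : ℕ}
    (hi : 1 ≤ i) (hij : i ≤ j) (hj : j ≤ t) : DReach E (x i) (x j) := by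
  induction j, hij using Nat.le_induction with
  | base => exact Relation.ReflTransGen.refl
  | succ k hik ih => exact (ih (by omega)).tail (hpath k (by omega) (by omega))

/-- A vertex strongly connected to a path vertex is reachable from every vertex which reaches
a path vertex of index at most the least one it reaches itself. -/
theorem dReach_of_mem_lowerBounds {V : Type*} {E : Set (V × V)} {t : ℕ} {x : ℕ → V}
    (hpath : ∀ i, 1 ≤ i → i < t → (x i, x (i + 1)) ∈ E) {a b : V} {p : ℕ}
    (hb : ∃ i, 1 ≤ i ∧ i ≤ t ∧ DSConn E b (x i)) (hp : 1 ≤ p) (hap : DReach E a (x p))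
    (hbp : p ∈ lowerBounds {i | 1 ≤ i ∧ i ≤ t ∧ DReach E b (x i)}) : DReach E a b := by
  obtain ⟨j, hj, hjt, hbj, hjb⟩ := hb
  exact (hap.trans (dReach_of_le hpath hp (hbp ⟨hj, hjt, hbj⟩) hjt)).trans hjb

/-- Lemma 6 of the paper. Let `H` be a directed graph,
`X = (x 1, …, x t)` a directed path in `H`, and `a, b` vertices whose SCCs in
`H` each contain a vertex of `X`.  Then `a` and `b` are strongly connected iff
`X^in(a) = X^in(b)` and `X^out(a) = X^out(b)` (where `X^in(w)` is the least
index `i` with `x i` reachable from `w`, and `X^out(w)` is the greatest index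
`i` with `w` reachable from `x i`). -/
theorem same_scc_iff_same_in_out {V : Type*} [Fintype V]
    (E : Set (V × V)) (t : ℕ) (x : ℕ → V)
    (hinj : ∀ i j, 1 ≤ i → i ≤ t → 1 ≤ j → j ≤ t → x i = x j → i = j)
    (hpath : ∀ i, 1 ≤ i → i < t → (x i, x (i + 1)) ∈ E)
    (a b : V)
    (ha : ∃ i, 1 ≤ i ∧ i ≤ t ∧ DSConn E a (x i))
    (hb : ∃ i, 1 ≤ i ∧ i ≤ t ∧ DSConn E b (x i)) :
    DSConn E a b ↔
      ∃ p q,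
        IsLeast {i | 1 ≤ i ∧ i ≤ t ∧ DReach E a (x i)} p ∧
        IsLeast {i | 1 ≤ i ∧ i ≤ t ∧ DReach E b (x i)} p ∧
        IsGreatest {i | 1 ≤ i ∧ i ≤ t ∧ DReach E (x i) a} q ∧
        IsGreatest {i | 1 ≤ i ∧ i ≤ t ∧ DReach E (x i) b} q := by
  constructor
  · rintro ⟨hab, hba⟩
    obtain ⟨i, hi, hit, hai, hia⟩ := ha
    have hin : {i | 1 ≤ i ∧ i ≤ t ∧ DReach E b (x i)} =
        {i | 1 ≤ i ∧ i ≤ t ∧ DReach E a (x i)} :=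
      Set.ext fun _ => and_congr_right fun _ => and_congr_right fun _ =>
        ⟨fun h => hab.trans h, fun h => hba.trans h⟩
    have hout : {i | 1 ≤ i ∧ i ≤ t ∧ DReach E (x i) b} =
        {i | 1 ≤ i ∧ i ≤ t ∧ DReach E (x i) a} :=
      Set.ext fun _ => and_congr_right fun _ => and_congr_right fun _ =>
        ⟨fun h => h.trans hba, fun h => h.trans hab⟩
    rw [hin, hout]
    have hp := isLeast_csInf (s := {i | 1 ≤ i ∧ i ≤ t ∧ DReach E a (x i)}) ⟨i, hi, hit, hai⟩
    obtain ⟨q, hq⟩ := BddAbove.exists_isGreatest_of_nonempty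
      (S := {i | 1 ≤ i ∧ i ≤ t ∧ DReach E (x i) a}) ⟨t, fun _ h => h.2.1⟩ ⟨i, hi, hit, hia⟩
    exact ⟨_, q, hp, hp, hq, hq⟩
  · rintro ⟨p, -, ⟨⟨hp, -, hap⟩, hpa⟩, ⟨⟨-, -, hbp⟩, hpb⟩, -, -⟩
    exact ⟨dReach_of_mem_lowerBounds hpath hb hp hap hpb,
      dReach_of_mem_lowerBounds hpath ha hp hbp hpa⟩
end

section
/- Let H be a directed graph on a finite vertex set V, let X = (x_1, …, x_t) be a directed path in H, and let 1 ≤ i ≤ mid ≤ j ≤ t. Let A = {v ∈ V : X^out(v) exists and i ≤ X^out(v) ≤ j} and let B = {v ∈ A : v is reachable from x_mid in H}. Then B = {v ∈ V : X^out(v) exists and mid ≤ X^out(v) ≤ j} and A ∖ B = {v ∈ V : X^out(v) exists and i ≤ X^out(v) ≤ mid − 1}. -/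
/-- Along a directed path `x 1, …, x t`, later vertices are reachable from earlier ones. -/
theorem DReach.of_path_s8 {V : Type*} {E : Set (V × V)} {t : ℕ} {x : ℕ → V}
    (hpath : ∀ i, 1 ≤ i → i < t → (x i, x (i + 1)) ∈ E)
    {a b : ℕ} (ha : 1 ≤ a) (hab : a ≤ b) (hb : b ≤ t) : DReach E (x a) (x b) := by
  induction b, hab using Nat.le_induction with
  | base => exact Relation.ReflTransGen.refl
  | succ n han ih => exact (ih (by omega)).tail (hpath n (by omega) (by omega))

/-- A vertex is reachable from `x m` exactly when `m` is at most the greatest index of a path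
vertex reaching it. -/
theorem dReach_iff_le_of_isGreatest {V : Type*} {E : Set (V × V)} {t : ℕ} {x : ℕ → V}
    (hpath : ∀ i, 1 ≤ i → i < t → (x i, x (i + 1)) ∈ E)
    {m o : ℕ} {v : V} (hm : 1 ≤ m) (hmt : m ≤ t)
    (ho : IsGreatest {l | 1 ≤ l ∧ l ≤ t ∧ DReach E (x l) v} o) :
    DReach E (x m) v ↔ m ≤ o :=
  ⟨fun h => ho.2 ⟨hm, hmt, h⟩, fun h =>
    Relation.ReflTransGen.trans (DReach.of_path_s8 hpath hm h ho.1.2.1) ho.1.2.2⟩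

/-- Assertion 1, the Binary-Search invariant. Let `H` be a
directed graph, `X = (x 1, …, x t)` a directed path in `H`, and
`1 ≤ i ≤ mid ≤ j ≤ t`.  Let `A` be the set of vertices `v` whose `X^out(v)`
(the greatest index `l` with `v` reachable from `x l`) exists and lies in
`[i, j]`, and let `B` be the set of vertices of `A` reachable from `x mid`.
Then `B` is exactly the set of vertices whose `X^out` lies in `[mid, j]`, and
`A ∖ B` is exactly the set of vertices whose `X^out` lies in `[i, mid − 1]`. -/
theorem binary_search_invariant {V : Type*} [Fintype V]
    (E : Set (V × V)) (t : ℕ) (x : ℕ → V)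
    (hinj : ∀ i j, 1 ≤ i → i ≤ t → 1 ≤ j → j ≤ t → x i = x j → i = j)
    (hpath : ∀ i, 1 ≤ i → i < t → (x i, x (i + 1)) ∈ E)
    (i mid j : ℕ) (h1 : 1 ≤ i) (h2 : i ≤ mid) (h3 : mid ≤ j) (h4 : j ≤ t)
    (A B : Set V)
    (hA : A = {v | ∃ o, IsGreatest {l | 1 ≤ l ∧ l ≤ t ∧ DReach E (x l) v} o ∧
      i ≤ o ∧ o ≤ j})
    (hB : B = {v ∈ A | DReach E (x mid) v}) :
    B = {v | ∃ o, IsGreatest {l | 1 ≤ l ∧ l ≤ t ∧ DReach E (x l) v} o ∧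
        mid ≤ o ∧ o ≤ j} ∧
    A \ B = {v | ∃ o, IsGreatest {l | 1 ≤ l ∧ l ≤ t ∧ DReach E (x l) v} o ∧
        i ≤ o ∧ o ≤ mid - 1} := by
  have key {v : V} {o : ℕ}
      (ho : IsGreatest {l | 1 ≤ l ∧ l ≤ t ∧ DReach E (x l) v} o) :
      DReach E (x mid) v ↔ mid ≤ o :=
    dReach_iff_le_of_isGreatest hpath (h1.trans h2) (h3.trans h4) ho
  subst hB hA
  constructor
  · ext v
    constructor
    · rintro ⟨⟨o, ho, -, hoj⟩, hv⟩
      exact ⟨o, ho, (key ho).1 hv, hoj⟩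
    · rintro ⟨o, ho, hmo, hoj⟩
      exact ⟨⟨o, ho, h2.trans hmo, hoj⟩, (key ho).2 hmo⟩
  · ext v
    constructor
    · rintro ⟨⟨o, ho, hio, hoj⟩, hv⟩
      have hlt : ¬ mid ≤ o := fun h => hv ⟨⟨o, ho, hio, hoj⟩, (key ho).2 h⟩
      exact ⟨o, ho, hio, by omega⟩
    · rintro ⟨o, ho, hio, hom⟩
      refine ⟨⟨o, ho, hio, by omega⟩, fun hv => ?_⟩
      have hmo := (key ho).1 hv.2
      omega
end
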